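/- In the ring ℚ[x][[t]], the following identity holds: (1 + Σ_{n≥1} (t^{3n}/(3n)!) · Σ_{σ ∈ SF_n} x^{risL(σ)}) · (1 − Σ_{n≥1} (t^{3n}/(3n)!) (x−1)^{n−1} · ILF_n) = 1. -/

import Mathlib

/-- `SF n`: binary-shrub-forest permutations of size `n`, modeled as permutations of
`Fin (3*n)` (0-based; position `p` corresponds to 1-based position `p+1`):
for every `0 ≤ i ≤ n-1`, `σ(3i+1) < σ(3i+2)` and `σ(3i+1) < σ(3i+3)` (1-based). -/
def SF (n : ℕ) : Finset (Equiv.Perm (Fin (3*n))) :=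
  Finset.univ.filter fun σ =>
    ∀ i < n, ∃ h : 3*i+2 < 3*n,
      σ ⟨3*i, by omega⟩ < σ ⟨3*i+1, by omega⟩ ∧ σ ⟨3*i, by omega⟩ < σ ⟨3*i+2, h⟩

/-- 0-based shrub index `j` is a lexicographic rise (1-based rise index `i = j+1`):
`σ(3i-2) < σ(3i+1)`, `σ(3i-1) < σ(3i+2)` and `σ(3i) < σ(3i+3)` in 1-based terms. -/
def lexRise (n : ℕ) (σ : Equiv.Perm (Fin (3*n))) (j : ℕ) : Prop :=
  ∃ h : 3*j+5 < 3*n,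
    σ ⟨3*j, by omega⟩ < σ ⟨3*j+3, by omega⟩ ∧
    σ ⟨3*j+1, by omega⟩ < σ ⟨3*j+4, by omega⟩ ∧
    σ ⟨3*j+2, by omega⟩ < σ ⟨3*j+5, h⟩

instance (n : ℕ) (σ : Equiv.Perm (Fin (3*n))) : DecidablePred (lexRise n σ) :=
  fun _ => by unfold lexRise; infer_instance

/-- `risL σ`: the number of lexicographic rises of `σ`. -/
def risL (n : ℕ) (σ : Equiv.Perm (Fin (3*n))) : ℕ :=
  ((Finset.range n).filter (lexRise n σ)).card

/-- `ILF n`: the number of `σ ∈ SF n` for which every `i ∈ {1,…,n-1}` is a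
lexicographic rise. -/
def ILF (n : ℕ) : ℕ := ((SF n).filter fun σ => ∀ j < n - 1, lexRise n σ j).card

/-- The EGF `1 + Σ_{n≥1} (t^(3n)/(3n)!) Σ_{σ ∈ SF n} x^(risL σ)` in `ℚ[x][[t]]`. -/
noncomputable def RLser : PowerSeries (Polynomial ℚ) :=
  PowerSeries.mk fun m =>
    if m = 0 then 1
    else if m % 3 = 0 then
      Polynomial.C ((m.factorial : ℚ)⁻¹) * ∑ σ ∈ SF (m / 3), Polynomial.X ^ risL (m / 3) σ
    else 0

/-- The series `1 - Σ_{n≥1} (t^(3n)/(3n)!) (x-1)^(n-1) ⋅ ILF n` in `ℚ[x][[t]]`. -/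
noncomputable def GLser : PowerSeries (Polynomial ℚ) :=
  PowerSeries.mk fun m =>
    if m = 0 then 1
    else if m % 3 = 0 then
      -(Polynomial.C ((m.factorial : ℚ)⁻¹) * (Polynomial.X - 1) ^ (m / 3 - 1) *
        (ILF (m / 3) : Polynomial ℚ))
    else 0

/-- Position `i` carries a smaller value of `σ` than position `j`; false out of range. -/
def ValueLT {N : ℕ} (σ : Equiv.Perm (Fin N)) (i j : ℕ) : Prop :=
  ∃ (hi : i < N) (hj : j < N), σ ⟨i, hi⟩ < σ ⟨j, hj⟩

lemma card_compl_of_add_eq {a b N : ℕ} (h : a + b = N)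
    (S : {S : Finset (Fin N) // S.card = a}) : (S.1)ᶜ.card = b := by
  rw [Finset.card_compl, S.2, Fintype.card_fin, ← h, Nat.add_sub_cancel_left]

/-- The permutation of `Fin N` whose first `a` values form the set `S` and are arranged in the
pattern `π`, and whose last `b` values are arranged in the pattern `ρ`. -/
def shufflePerm {a b N : ℕ} (h : a + b = N) (S : {S : Finset (Fin N) // S.card = a})
    (π : Equiv.Perm (Fin a)) (ρ : Equiv.Perm (Fin b)) : Equiv.Perm (Fin N) :=
  ((finSumFinEquiv.trans (finCongr h)).symm.trans (Equiv.sumCongr π ρ)).trans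
    (finSumEquivOfFinset S.2 (card_compl_of_add_eq h S))

section Shuffle

variable {a b N : ℕ} (h : a + b = N) (S : {S : Finset (Fin N) // S.card = a})
  (π : Equiv.Perm (Fin a)) (ρ : Equiv.Perm (Fin b))

lemma shufflePerm_left (i : ℕ) (hi : i < a) :
    shufflePerm h S π ρ ⟨i, by omega⟩ = S.1.orderEmbOfFin S.2 (π ⟨i, hi⟩) := by
  have : (⟨i, by omega⟩ : Fin N) = (finSumFinEquiv.trans (finCongr h)) (Sum.inl ⟨i, hi⟩) := by
    ext; simp
  rw [this, shufflePerm, Equiv.trans_apply, Equiv.trans_apply, Equiv.symm_apply_apply]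
  simp

lemma shufflePerm_right (i : ℕ) (hi : i < b) :
    shufflePerm h S π ρ ⟨a + i, by omega⟩ =
      (S.1)ᶜ.orderEmbOfFin (card_compl_of_add_eq h S) (ρ ⟨i, hi⟩) := by
  have : (⟨a + i, by omega⟩ : Fin N) =
      (finSumFinEquiv.trans (finCongr h)) (Sum.inr ⟨i, hi⟩) := by
    ext; simp
  rw [this, shufflePerm, Equiv.trans_apply, Equiv.trans_apply, Equiv.symm_apply_apply]
  simp

lemma valueLT_shufflePerm_left {i j : ℕ} (hi : i < a) (hj : j < a) :
    ValueLT (shufflePerm h S π ρ) i j ↔ ValueLT π i j := by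
  have hi' : i < N := by omega
  have hj' : j < N := by omega
  simp [ValueLT, hi, hj, hi', hj', shufflePerm_left]

lemma valueLT_shufflePerm_right (i j : ℕ) :
    ValueLT (shufflePerm h S π ρ) (a + i) (a + j) ↔ ValueLT ρ i j := by
  constructor
  · rintro ⟨hi, hj, hlt⟩
    have hi' : i < b := by omega
    have hj' : j < b := by omega
    rw [shufflePerm_right h S π ρ i hi', shufflePerm_right h S π ρ j hj'] at hlt
    exact ⟨hi', hj', by simpa using hlt⟩
  · rintro ⟨hi, hj, hlt⟩
    refine ⟨by omega, by omega, ?_⟩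
    rw [shufflePerm_right h S π ρ i hi, shufflePerm_right h S π ρ j hj]
    simpa using hlt

lemma mem_iff_shufflePerm_lt (x : Fin N) :
    x ∈ S.1 ↔ ∃ (i : ℕ) (hi : i < a), shufflePerm h S π ρ ⟨i, by omega⟩ = x := by
  constructor
  · intro hx
    obtain ⟨k, rfl⟩ : x ∈ Set.range (S.1.orderEmbOfFin S.2) := by
      rw [Finset.range_orderEmbOfFin]; exact hx
    refine ⟨(π.symm k).1, (π.symm k).2, ?_⟩
    rw [shufflePerm_left h S π ρ _ (π.symm k).2]
    simp
  · rintro ⟨i, hi, rfl⟩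
    rw [shufflePerm_left h S π ρ i hi]
    exact Finset.orderEmbOfFin_mem _ _ _

lemma shufflePerm_bijective :
    Function.Bijective fun x : {S : Finset (Fin N) // S.card = a} ×
      Equiv.Perm (Fin a) × Equiv.Perm (Fin b) => shufflePerm h x.1 x.2.1 x.2.2 := by
  rw [Fintype.bijective_iff_injective_and_card]
  constructor
  · rintro ⟨S, π, ρ⟩ ⟨S', π', ρ'⟩ heq
    dsimp only at heq
    obtain rfl : S = S' := by
      ext x
      rw [mem_iff_shufflePerm_lt h S π ρ, mem_iff_shufflePerm_lt h S' π' ρ', heq]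
    obtain rfl : π = π' := by
      ext1 ⟨i, hi⟩
      apply (S.1.orderEmbOfFin S.2).injective
      rw [← shufflePerm_left h S π ρ i hi, ← shufflePerm_left h S π' ρ' i hi, heq]
    obtain rfl : ρ = ρ' := by
      ext1 ⟨i, hi⟩
      apply ((S.1)ᶜ.orderEmbOfFin (card_compl_of_add_eq h S)).injective
      rw [← shufflePerm_right h S π ρ i hi, ← shufflePerm_right h S π ρ' i hi, heq]
    rfl
  · simp only [Fintype.card_prod, Fintype.card_finset_len, Fintype.card_perm, Fintype.card_fin]
    rw [← mul_assoc, ← Nat.choose_mul_factorial_mul_factorial (by omega : a ≤ N)]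
    congr 3
    omega

lemma sum_perm_eq_choose_mul {R : Type*} [CommSemiring R] (f : Equiv.Perm (Fin N) → R)
    (F : Equiv.Perm (Fin a) → R) (G : Equiv.Perm (Fin b) → R)
    (hf : ∀ S π ρ, f (shufflePerm h S π ρ) = F π * G ρ) :
    ∑ σ, f σ = (N.choose a : R) * ((∑ π, F π) * ∑ ρ, G ρ) := by
  rw [← (shufflePerm_bijective h).sum_comp]
  simp only [hf, Fintype.sum_prod_type, Finset.sum_const, Finset.card_univ,
    Fintype.card_finset_len, Fintype.card_fin, nsmul_eq_mul, Finset.sum_mul_sum]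

end Shuffle

lemma mem_SF_iff {n : ℕ} {σ : Equiv.Perm (Fin (3 * n))} :
    σ ∈ SF n ↔ ∀ i < n, ValueLT σ (3 * i) (3 * i + 1) ∧ ValueLT σ (3 * i) (3 * i + 2) := by
  simp only [SF, Finset.mem_filter, Finset.mem_univ, true_and]
  refine forall₂_congr fun i hi => ?_
  have h0 : 3 * i < 3 * n := by omega
  have h1 : 3 * i + 1 < 3 * n := by omega
  have h2 : 3 * i + 2 < 3 * n := by omega
  simp [ValueLT, h0, h1, h2]

lemma lexRise_iff {n : ℕ} {σ : Equiv.Perm (Fin (3 * n))} {j : ℕ} :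
    lexRise n σ j ↔ ValueLT σ (3 * j) (3 * j + 3) ∧ ValueLT σ (3 * j + 1) (3 * j + 4) ∧
      ValueLT σ (3 * j + 2) (3 * j + 5) := by
  constructor
  · rintro ⟨h, h0, h1, h2⟩
    exact ⟨⟨_, _, h0⟩, ⟨_, _, h1⟩, ⟨_, _, h2⟩⟩
  · rintro ⟨⟨_, _, h0⟩, ⟨_, _, h1⟩, ⟨_, h, h2⟩⟩
    exact ⟨h, h0, h1, h2⟩

lemma lexRise.succ_lt {n : ℕ} {σ : Equiv.Perm (Fin (3 * n))} {j : ℕ} (h : lexRise n σ j) :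
    j + 1 < n := by
  obtain ⟨h, -⟩ := h
  omega

lemma risL_eq_card_range_pred (n : ℕ) (σ : Equiv.Perm (Fin (3 * n))) :
    risL n σ = ((Finset.range (n - 1)).filter (lexRise n σ)).card := by
  unfold risL
  congr 1
  ext j
  simp only [Finset.mem_filter, Finset.mem_range]
  constructor
  · rintro ⟨-, hj⟩
    exact ⟨by have := hj.succ_lt; omega, hj⟩
  · rintro ⟨h, hj⟩
    exact ⟨by omega, hj⟩

section ShuffleBlocks

variable {p q n : ℕ} (h : 3 * p + 3 * q = 3 * n)
  (S : {S : Finset (Fin (3 * n)) // S.card = 3 * p})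
  (π : Equiv.Perm (Fin (3 * p))) (ρ : Equiv.Perm (Fin (3 * q)))

lemma shufflePerm_mem_SF_iff :
    shufflePerm h S π ρ ∈ SF n ↔ π ∈ SF p ∧ ρ ∈ SF q := by
  have left (i : ℕ) (hi : i < p) (c : ℕ) (hc : c < 3) :
      ValueLT (shufflePerm h S π ρ) (3 * i) (3 * i + c) ↔ ValueLT π (3 * i) (3 * i + c) :=
    valueLT_shufflePerm_left h S π ρ (by omega) (by omega)
  have right (i c : ℕ) :
      ValueLT (shufflePerm h S π ρ) (3 * (p + i)) (3 * (p + i) + c) ↔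
        ValueLT ρ (3 * i) (3 * i + c) := by
    rw [mul_add, add_assoc]
    exact valueLT_shufflePerm_right h S π ρ _ _
  simp only [mem_SF_iff]
  constructor
  · intro H
    refine ⟨fun i hi => ?_, fun i hi => ?_⟩
    · rw [← left i hi 1 (by omega), ← left i hi 2 (by omega)]
      exact H i (by omega)
    · rw [← right i 1, ← right i 2]
      exact H (p + i) (by omega)
  · rintro ⟨Hp, Hq⟩ i hi
    rcases lt_or_ge i p with hip | hip
    · rw [left i hip 1 (by omega), left i hip 2 (by omega)]
      exact Hp i hip
    · obtain ⟨k, rfl⟩ := Nat.exists_eq_add_of_le hip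
      rw [right k 1, right k 2]
      exact Hq k (by omega)

lemma lexRise_shufflePerm_left {j : ℕ} (hj : j + 1 < p) :
    lexRise n (shufflePerm h S π ρ) j ↔ lexRise p π j := by
  rw [lexRise_iff, lexRise_iff, valueLT_shufflePerm_left, valueLT_shufflePerm_left,
    valueLT_shufflePerm_left] <;> omega

lemma lexRise_shufflePerm_right (j : ℕ) :
    lexRise n (shufflePerm h S π ρ) (p + j) ↔ lexRise q ρ j := by
  simp only [lexRise_iff, mul_add, add_assoc, valueLT_shufflePerm_right]

end ShuffleBlocks

open Polynomial in
/-- Expansion of `X ^ #{rises}` according to a marked run of rises at the end. -/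
lemma X_pow_card_filter_eq_sum (b : ℕ → Prop) [DecidablePred b] (n : ℕ) :
    (X : ℚ[X]) ^ ((Finset.range n).filter b).card =
      ∑ p ∈ Finset.range (n + 1), if ∀ j < n - p, b (p + j) then
        X ^ ((Finset.range (p - 1)).filter b).card * (X - 1) ^ (n - p) else 0 := by
  induction n with
  | zero => simp
  | succ n ih =>
    rw [Finset.sum_range_succ]
    have hlast (p : ℕ) (hp : p ∈ Finset.range (n + 1)) :
        (if ∀ j < n + 1 - p, b (p + j) then
          X ^ ((Finset.range (p - 1)).filter b).card * (X - 1 : ℚ[X]) ^ (n + 1 - p) else 0) =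
        (if b n then X - 1 else 0) * if ∀ j < n - p, b (p + j) then
          X ^ ((Finset.range (p - 1)).filter b).card * (X - 1 : ℚ[X]) ^ (n - p) else 0 := by
      have hpn : p ≤ n := by simpa [Nat.lt_succ_iff] using hp
      have hiff : (∀ j < n + 1 - p, b (p + j)) ↔ (∀ j < n - p, b (p + j)) ∧ b n := by
        rw [Nat.sub_add_comm hpn, Nat.forall_lt_succ_right, Nat.add_sub_cancel' hpn]
      rw [if_congr hiff rfl rfl, Nat.sub_add_comm hpn, pow_succ]
      split_ifs <;> first | tauto | ring
    rw [Finset.sum_congr rfl hlast, ← Finset.mul_sum, ← ih, Finset.range_add_one,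
      Finset.filter_insert]
    by_cases hb : b n
    · simp [hb, pow_succ]
      ring
    · simp [hb]

/-- The rise polynomial `∑ σ ∈ SF n, X ^ risL σ`. -/
noncomputable def risePoly (n : ℕ) : Polynomial ℚ := ∑ σ ∈ SF n, Polynomial.X ^ risL n σ

lemma risePoly_zero : risePoly 0 = 1 := by
  have huniv : SF 0 = Finset.univ := by simp [SF]
  have hris (σ : Equiv.Perm (Fin (3 * 0))) : risL 0 σ = 0 := by simp [risL]
  simp [risePoly, huniv, hris]

open Polynomial in
lemma sum_SF_marked_final_run {n p q : ℕ} (hpq : p + q = n) :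
    (∑ σ ∈ SF n, if ∀ j < q - 1, lexRise n σ (p + j) then
      X ^ ((Finset.range (p - 1)).filter (lexRise n σ)).card * (X - 1 : ℚ[X]) ^ (q - 1) else 0) =
    ((3 * n).choose (3 * p) : ℚ[X]) * (risePoly p * ((X - 1) ^ (q - 1) * (ILF q : ℚ[X]))) := by
  have h : 3 * p + 3 * q = 3 * n := by omega
  have hG : (X - 1) ^ (q - 1) * (ILF q : ℚ[X]) =
      ∑ ρ, if ρ ∈ SF q ∧ ∀ j < q - 1, lexRise q ρ j then (X - 1) ^ (q - 1) else 0 := by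
    rw [← Finset.sum_filter, Finset.sum_const, nsmul_eq_mul, mul_comm, ILF]
    congr 3
    ext ρ
    simp
  have hF : risePoly p = ∑ π, if π ∈ SF p then X ^ risL p π else 0 := by
    rw [risePoly, ← Finset.sum_filter]
    congr 1
    ext π
    simp
  rw [hG, hF, ← Finset.univ_inter (SF n), ← Finset.sum_ite_mem]
  refine sum_perm_eq_choose_mul h _ _ _ fun S π ρ => ?_
  have hcard : ((Finset.range (p - 1)).filter (lexRise n (shufflePerm h S π ρ))).card =
      risL p π := by
    rw [risL_eq_card_range_pred]
    congr 1
    refine Finset.filter_congr fun j hj => lexRise_shufflePerm_left h S π ρ ?_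
    have := Finset.mem_range.mp hj
    omega
  simp only [shufflePerm_mem_SF_iff, lexRise_shufflePerm_right, hcard]
  split_ifs <;> first | tauto | simp

open Polynomial in
lemma risePoly_succ (n : ℕ) :
    risePoly (n + 1) = ∑ p ∈ Finset.range (n + 1), ((3 * (n + 1)).choose (3 * p) : ℚ[X]) *
      (risePoly p * ((X - 1) ^ (n - p) * (ILF (n + 1 - p) : ℚ[X]))) := by
  rw [risePoly]
  simp only [risL_eq_card_range_pred, Nat.add_sub_cancel]
  rw [Finset.sum_congr rfl fun σ _ => X_pow_card_filter_eq_sum (lexRise (n + 1) σ) n,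
    Finset.sum_comm]
  refine Finset.sum_congr rfl fun p hp => ?_
  have hp' : p < n + 1 := Finset.mem_range.mp hp
  have hq : n + 1 - p - 1 = n - p := by omega
  have := sum_SF_marked_final_run (n := n + 1) (p := p) (q := n + 1 - p) (by omega)
  rwa [hq] at this

/-- `RLser` as a series in `t ^ 3`. -/
noncomputable def risePolySeries : PowerSeries (Polynomial ℚ) :=
  PowerSeries.mk fun n => Polynomial.C (((3 * n).factorial : ℚ)⁻¹) * risePoly n

/-- `GLser` as a series in `t ^ 3`. -/
noncomputable def lexForestSeries : PowerSeries (Polynomial ℚ) :=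
  PowerSeries.mk fun n => if n = 0 then 1 else
    -(Polynomial.C (((3 * n).factorial : ℚ)⁻¹) * (Polynomial.X - 1) ^ (n - 1) *
      (ILF n : Polynomial ℚ))

lemma RLser_eq_expand : RLser = PowerSeries.expand 3 three_ne_zero risePolySeries := by
  ext1 m
  rw [PowerSeries.coeff_expand, RLser, risePolySeries, PowerSeries.coeff_mk]
  by_cases hm : 3 ∣ m
  · obtain ⟨k, rfl⟩ := hm
    rcases eq_or_ne k 0 with rfl | hk
    · simp [risePoly_zero]
    · rw [Nat.mul_div_cancel_left k three_pos]
      simp [hk, risePoly]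
  · have h0 : m ≠ 0 := by rintro rfl; simp at hm
    simp [hm, h0, mt Nat.dvd_of_mod_eq_zero hm]

lemma GLser_eq_expand : GLser = PowerSeries.expand 3 three_ne_zero lexForestSeries := by
  ext1 m
  rw [PowerSeries.coeff_expand, GLser, lexForestSeries, PowerSeries.coeff_mk]
  by_cases hm : 3 ∣ m
  · obtain ⟨k, rfl⟩ := hm
    simp
  · have h0 : m ≠ 0 := by rintro rfl; simp at hm
    simp [hm, h0, mt Nat.dvd_of_mod_eq_zero hm]

open Polynomial in
lemma risePolySeries_mul_lexForestSeries : risePolySeries * lexForestSeries = 1 := by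
  ext1 n
  rw [PowerSeries.coeff_mul, Finset.Nat.sum_antidiagonal_eq_sum_range_succ_mk]
  cases n with
  | zero => simp [risePolySeries, lexForestSeries, risePoly_zero]
  | succ n =>
    have hterm (p : ℕ) (hp : p ∈ Finset.range (n + 1)) :
        PowerSeries.coeff p risePolySeries * PowerSeries.coeff (n + 1 - p) lexForestSeries =
        -(C (((3 * (n + 1)).factorial : ℚ)⁻¹) * (((3 * (n + 1)).choose (3 * p) : ℚ[X]) *
          (risePoly p * ((X - 1) ^ (n - p) * (ILF (n + 1 - p) : ℚ[X]))))) := by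
      have hp' : p < n + 1 := Finset.mem_range.mp hp
      have hne : n + 1 - p ≠ 0 := by omega
      have hq : n + 1 - p - 1 = n - p := by omega
      have hC : C (((3 * p).factorial : ℚ)⁻¹) * C (((3 * (n + 1 - p)).factorial : ℚ)⁻¹) =
          C (((3 * (n + 1)).factorial : ℚ)⁻¹) * ((3 * (n + 1)).choose (3 * p) : ℚ[X]) := by
        rw [← C_eq_natCast, ← C_mul, ← C_mul, Nat.cast_choose ℚ (by omega : 3 * p ≤ 3 * (n + 1)),
          Nat.mul_sub]
        congr 1
        have := Nat.factorial_ne_zero (3 * (n + 1))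
        field_simp
      simp only [risePolySeries, lexForestSeries, PowerSeries.coeff_mk, hne, if_false, hq]
      linear_combination (-(risePoly p * (X - 1) ^ (n - p) * (ILF (n + 1 - p) : ℚ[X]))) * hC
    rw [Finset.sum_range_succ, Finset.sum_congr rfl hterm, Finset.sum_neg_distrib,
      ← Finset.mul_sum, ← risePoly_succ]
    simp [risePolySeries, lexForestSeries, PowerSeries.coeff_one]

theorem RLser_mul : RLser * GLser = 1 := by
  rw [RLser_eq_expand, GLser_eq_expand, ← map_mul, risePolySeries_mul_lexForestSeries, map_one]
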